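/- arXiv:1507.04549 — 2 statements merged into one kernel-verified Lean document; each statement's English description precedes it below -/
import Mathlib

section
/- Let g, γ ∈ W(ℝ^d) and define G_{a,b;n}(x) = ∑_{k∈ℤ^d} ḡ(x − n/b − ak) γ(x − ak). Then lim_{(a,b)→(0,0)} ∑_{n∈ℤ^d, n≠0} a^d ‖G_{a,b;n}‖_∞ = 0. -/
open MeasureTheory ENNReal

noncomputable section

/-- Coercion of a lattice point `k ∈ ℤ^d` to `ℝ^d`. -/
def zVec {d : ℕ} (k : Fin d → ℤ) : Fin d → ℝ := fun i => (k i : ℝ)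

/-- The unit cube `Q = [0,1)^d` translated by `k ∈ ℤ^d`. -/
def block (d : ℕ) (k : Fin d → ℤ) : Set (Fin d → ℝ) :=
  {x | ∀ i, (k i : ℝ) ≤ x i ∧ x i < (k i : ℝ) + 1}

/-- `‖f · T_k χ_Q‖_p`, the local `L^p` norm of `f` on the cube `k + Q`. -/
def blockNorm (d : ℕ) (p : ℝ≥0∞) (f : (Fin d → ℝ) → ℂ) (k : Fin d → ℤ) : ℝ≥0∞ :=
  eLpNorm ((block d k).indicator f) p volume

/-- The Wiener space norm `‖f‖_{W(ℝ^d)} = ∑_{k∈ℤ^d} ‖f·T_k χ_Q‖_∞`. -/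
def wienerNorm (d : ℕ) (f : (Fin d → ℝ) → ℂ) : ℝ≥0∞ :=
  ∑' k : Fin d → ℤ, blockNorm d ∞ f k

/-- The Wiener amalgam norm `‖f‖_{W(L^p,ℓ^q)} = (∑_{k∈ℤ^d} ‖f·T_k χ_Q‖_p^q)^{1/q}`,
with the supremum in place of the sum when `q = ∞`. -/
def amalgamNorm (d : ℕ) (p q : ℝ≥0∞) (f : (Fin d → ℝ) → ℂ) : ℝ≥0∞ :=
  if q = ∞ then ⨆ k : Fin d → ℤ, blockNorm d p f k
  else (∑' k : Fin d → ℤ, blockNorm d p f k ^ q.toReal) ^ (1 / q.toReal)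

/-- The function `G_{a,b;n}(x) = ∑_{k∈ℤ^d} ḡ(x − n/b − ak) γ(x − ak)`. -/
def Gabn {d : ℕ} (g γ : (Fin d → ℝ) → ℂ) (a b : ℝ) (n : Fin d → ℤ) (x : Fin d → ℝ) : ℂ :=
  ∑' k : Fin d → ℤ,
    (starRingEnd ℂ) (g (x - b⁻¹ • zVec n - a • zVec k)) * γ (x - a • zVec k)

def flr {d : ℕ} (x : Fin d → ℝ) : Fin d → ℤ := fun i => ⌊x i⌋

def eVec {d : ℕ} (e : Fin d → Fin 2) : Fin d → ℤ := fun i => ((e i : ℕ) : ℤ)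

theorem mem_block_flr {d : ℕ} (x : Fin d → ℝ) : x ∈ block d (flr x) := fun i =>
  ⟨Int.floor_le _, Int.lt_floor_add_one _⟩

theorem ae_le_block {d : ℕ} (f : (Fin d → ℝ) → ℂ) :
    ∀ᵐ x : Fin d → ℝ, ‖f x‖ₑ ≤ blockNorm d ∞ f (flr x) := by
  have h : ∀ᵐ x : Fin d → ℝ, ∀ k : Fin d → ℤ,
      ‖(block d k).indicator f x‖ₑ ≤ blockNorm d ∞ f k := by
    rw [ae_all_iff]
    intro k
    unfold blockNorm
    rw [eLpNorm_exponent_top]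
    exact ae_le_eLpNormEssSup
  filter_upwards [h] with x hx
  have := hx (flr x)
  rwa [Set.indicator_of_mem (mem_block_flr x)] at this

theorem ae_le_block_sub {d : ℕ} (f : (Fin d → ℝ) → ℂ) (c : Fin d → ℝ) :
    ∀ᵐ x : Fin d → ℝ, ‖f (x - c)‖ₑ ≤ blockNorm d ∞ f (flr (x - c)) :=
  (measurePreserving_sub_right volume c).quasiMeasurePreserving.ae (ae_le_block f)

theorem flr_add {d : ℕ} (x y : Fin d → ℝ) :
    ∃ e : Fin d → Fin 2, flr (x + y) = flr x + flr y + eVec e := by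
  have h : ∀ i, ∃ e : Fin 2, ⌊x i + y i⌋ = ⌊x i⌋ + ⌊y i⌋ + ((e : ℕ) : ℤ) := by
    intro i
    have h1 := Int.le_floor_add (x i) (y i)
    have h2 := Int.le_floor_add_floor (x i) (y i)
    rcases (by omega : ⌊x i + y i⌋ = ⌊x i⌋ + ⌊y i⌋ ∨ ⌊x i + y i⌋ = ⌊x i⌋ + ⌊y i⌋ + 1) with h | h
    · exact ⟨0, by simpa using h⟩
    · exact ⟨1, by simpa using h⟩
  choose e he using h
  exact ⟨e, funext he⟩

theorem fiber_bound {d : ℕ} (a : ℝ) (ha : 0 < a) (ha1 : a < 1) (x : Fin d → ℝ)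
    (F : (Fin d → ℤ) → ℝ≥0∞) :
    ENNReal.ofReal (a ^ d) * ∑' k : Fin d → ℤ, F (flr (x - a • zVec k)) ≤ 2 ^ d * ∑' m, F m := by
  rw [← ENNReal.tsum_fiberwise _ (fun k : Fin d → ℤ => flr (x - a • zVec k)),
    ← ENNReal.tsum_mul_left, ← ENNReal.tsum_mul_left]
  refine ENNReal.tsum_le_tsum fun m => ?_
  let S : Finset (Fin d → ℤ) :=
    Fintype.piFinset fun i => Finset.Icc ⌈(x i - m i - 1) / a⌉ ⌊(x i - m i) / a⌋
  have hsub : ((fun k : Fin d → ℤ => flr (x - a • zVec k)) ⁻¹' {m}) ⊆ (S : Set (Fin d → ℤ)) := by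
    intro k hk
    simp only [Set.mem_preimage, Set.mem_singleton_iff] at hk
    simp only [S, Finset.mem_coe, Fintype.mem_piFinset, Finset.mem_Icc]
    intro i
    have hi := congrFun hk i
    simp only [flr, zVec, Pi.sub_apply, Pi.smul_apply, smul_eq_mul, Int.floor_eq_iff] at hi
    constructor
    · rw [Int.ceil_le, div_le_iff₀ ha]; nlinarith
    · rw [Int.le_floor, le_div_iff₀ ha]; nlinarith
  have hcard : ENNReal.ofReal (a ^ d) * (S.card : ℝ≥0∞) ≤ 2 ^ d := by
    have h1 : (S.card : ℝ) ≤ (1 / a + 1) ^ d := by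
      simp only [S, Fintype.card_piFinset, Nat.cast_prod]
      refine (Finset.prod_le_prod (fun _ _ => by positivity) (g := fun _ => 1 / a + 1) ?_).trans ?_
      · intro i _
        rw [Int.card_Icc]
        have h2 := Int.floor_le ((x i - m i) / a)
        have h3 := Int.le_ceil ((x i - m i - 1) / a)
        have h4 : (x i - m i) / a - (x i - m i - 1) / a = 1 / a := by ring
        have h5 : 0 < 1 / a := by positivity
        have h6 : ((⌊(x i - m i) / a⌋ + 1 - ⌈(x i - m i - 1) / a⌉ : ℤ) : ℝ) ≤ 1 / a + 1 := by
          push_cast; linarith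
        generalize (⌊(x i - m i) / a⌋ + 1 - ⌈(x i - m i - 1) / a⌉ : ℤ) = z at *
        rcases le_total 0 z with hz | hz
        · have : ((z.toNat : ℕ) : ℝ) = (z : ℝ) := by exact_mod_cast Int.toNat_of_nonneg hz
          rw [this]; exact h6
        · rw [Int.toNat_of_nonpos hz]; push_cast; linarith
      · simp
    have h2 : a ^ d * (S.card : ℝ) ≤ 2 ^ d := by
      calc a ^ d * (S.card : ℝ) ≤ a ^ d * (1 / a + 1) ^ d := by gcongr
        _ = (1 + a) ^ d := by rw [← mul_pow]; congr 1; field_simp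
        _ ≤ 2 ^ d := by gcongr; linarith
    calc ENNReal.ofReal (a ^ d) * (S.card : ℝ≥0∞)
        = ENNReal.ofReal (a ^ d * (S.card : ℝ)) := by
          rw [ENNReal.ofReal_mul (by positivity), ENNReal.ofReal_natCast]
      _ ≤ ENNReal.ofReal (2 ^ d) := ENNReal.ofReal_le_ofReal h2
      _ = 2 ^ d := by rw [ENNReal.ofReal_pow (by norm_num)]; simp
  have hs : ∑' b : ↥((fun k : Fin d → ℤ => flr (x - a • zVec k)) ⁻¹' {m}),
      F (flr (x - a • zVec b.1)) ≤ S.card * F m := by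
    calc _ = ∑' b : ↥((fun k : Fin d → ℤ => flr (x - a • zVec k)) ⁻¹' {m}),
          (fun _ : Fin d → ℤ => F m) b.1 := by
          refine tsum_congr fun b => ?_
          have : flr (x - a • zVec b.1) = m := b.2
          rw [this]
      _ ≤ ∑' b : ↥(S : Set (Fin d → ℤ)), (fun _ : Fin d → ℤ => F m) b.1 :=
          ENNReal.tsum_mono_subtype (fun _ : Fin d → ℤ => F m) hsub
      _ = ∑ b ∈ S, F m := Finset.tsum_subtype S (fun _ : Fin d → ℤ => F m)
      _ = S.card * F m := by simp
  calc _ ≤ ENNReal.ofReal (a ^ d) * (S.card * F m) := by gcongr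
    _ = (ENNReal.ofReal (a ^ d) * S.card) * F m := by ring
    _ ≤ _ := by gcongr

/-- The majorant. -/
def Hmaj (d : ℕ) (u v : (Fin d → ℤ) → ℝ≥0∞) (l : Fin d → ℤ) : ℝ≥0∞ :=
  2 ^ d * ∑' m : Fin d → ℤ, v m * ∑ e : Fin d → Fin 2, u (m + l + eVec e)

theorem Hmaj_sum {d : ℕ} (u v : (Fin d → ℤ) → ℝ≥0∞) (hu : ∑' k, u k < ∞) (hv : ∑' k, v k < ∞) :
    ∑' l, Hmaj d u v l ≠ ∞ := by
  have h1 : ∀ (m : Fin d → ℤ) (e : Fin d → Fin 2), ∑' l, u (m + l + eVec e) = ∑' k, u k := by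
    intro m e
    have := ((Equiv.addLeft m).trans (Equiv.addRight (eVec e))).tsum_eq u
    simpa using this
  have h2 : ∑' l, Hmaj d u v l =
      2 ^ d * ((∑' k, v k) * ∑ e : Fin d → Fin 2, ∑' k, u k) := by
    unfold Hmaj
    rw [ENNReal.tsum_mul_left, ENNReal.tsum_comm, ← ENNReal.tsum_mul_right]
    congr 1
    refine tsum_congr fun m => ?_
    rw [ENNReal.tsum_mul_left, Summable.tsum_finsetSum (fun _ _ => ENNReal.summable)]
    simp only [h1]
  rw [h2]
  refine ENNReal.mul_ne_top (by simp) (ENNReal.mul_ne_top hv.ne ?_)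
  exact ENNReal.sum_ne_top.2 fun _ _ => hu.ne

theorem term_bound {d : ℕ} (g γ : (Fin d → ℝ) → ℂ) (a b : ℝ) (ha : 0 < a) (ha1 : a < 1)
    (n : Fin d → ℤ) :
    ENNReal.ofReal (a ^ d) * eLpNorm (Gabn g γ a b n) ∞ volume ≤
      Hmaj d (blockNorm d ∞ g) (blockNorm d ∞ γ) (flr (-(b⁻¹ • zVec n))) := by
  set u := blockNorm d ∞ g
  set v := blockNorm d ∞ γ
  set l := flr (-(b⁻¹ • zVec n)) with hl
  set c := ENNReal.ofReal (a ^ d) with hc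
  have hc0 : c ≠ 0 := by simp only [hc, ne_eq, ENNReal.ofReal_eq_zero, not_le]; positivity
  have hct : c ≠ ∞ := ENNReal.ofReal_ne_top
  rw [mul_comm, ← ENNReal.le_div_iff_mul_le (Or.inl hc0) (Or.inl hct), eLpNorm_exponent_top]
  apply eLpNormEssSup_le_of_ae_enorm_bound
  have hA : ∀ᵐ x : Fin d → ℝ, ∀ k : Fin d → ℤ,
      ‖g (x - (b⁻¹ • zVec n + a • zVec k))‖ₑ ≤ u (flr (x - (b⁻¹ • zVec n + a • zVec k))) :=
    ae_all_iff.2 fun k => ae_le_block_sub g _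
  have hB : ∀ᵐ x : Fin d → ℝ, ∀ k : Fin d → ℤ,
      ‖γ (x - a • zVec k)‖ₑ ≤ v (flr (x - a • zVec k)) :=
    ae_all_iff.2 fun k => ae_le_block_sub γ _
  filter_upwards [hA, hB] with x hx hy
  rw [ENNReal.le_div_iff_mul_le (Or.inl hc0) (Or.inl hct), mul_comm]
  refine le_trans ?_ (fiber_bound a ha ha1 x
    (fun m => v m * ∑ e : Fin d → Fin 2, u (m + l + eVec e)))
  gcongr
  unfold Gabn
  refine enorm_tsum_le_tsum_enorm.trans (ENNReal.tsum_le_tsum fun k => ?_)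
  rw [enorm_mul, mul_comm]
  gcongr
  · exact hy k
  · have h1 : ‖(starRingEnd ℂ) (g (x - b⁻¹ • zVec n - a • zVec k))‖ₑ
        = ‖g (x - (b⁻¹ • zVec n + a • zVec k))‖ₑ := by
      rw [sub_sub]
      exact RCLike.enorm_conj _
    rw [h1]
    refine (hx k).trans ?_
    obtain ⟨e, he⟩ := flr_add (x - a • zVec k) (-(b⁻¹ • zVec n))
    have h2 : x - (b⁻¹ • zVec n + a • zVec k) = x - a • zVec k + -(b⁻¹ • zVec n) := by abel
    rw [h2, he]
    exact Finset.single_le_sum (f := fun e => u (flr (x - a • zVec k) + l + eVec e))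
      (fun _ _ => zero_le) (Finset.mem_univ e)

theorem l_inj {d : ℕ} (b : ℝ) (hb : 0 < b) (hb1 : b < 1) :
    Function.Injective fun n : Fin d → ℤ => flr (-(b⁻¹ • zVec n)) := by
  intro n n' h
  funext i
  have hi := congrFun h i
  simp only [flr, zVec, Pi.neg_apply, Pi.smul_apply, smul_eq_mul] at hi
  have h1 := Int.abs_sub_lt_one_of_floor_eq_floor hi
  have h2 : 1 < b⁻¹ := (one_lt_inv₀ hb).2 hb1
  have h3 : -(b⁻¹ * (n i : ℝ)) - -(b⁻¹ * (n' i : ℝ)) = b⁻¹ * (((n' i - n i : ℤ)) : ℝ) := by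
    push_cast; ring
  rw [h3, abs_mul, abs_of_pos (by positivity)] at h1
  by_contra hne
  have h4 : (1 : ℤ) ≤ |n' i - n i| := Int.one_le_abs (by omega)
  have h5 : (1 : ℝ) ≤ |((n' i - n i : ℤ) : ℝ)| := by exact_mod_cast h4
  nlinarith

theorem l_avoid {d : ℕ} (s : Finset (Fin d → ℤ)) : ∃ δ > (0 : ℝ), ∀ b : ℝ, 0 < b → b < δ →
    ∀ n : Fin d → ℤ, n ≠ 0 → flr (-(b⁻¹ • zVec n)) ∉ s := by
  let M : ℤ := ∑ l ∈ s, ∑ i, |l i|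
  have hM0 : 0 ≤ M := Finset.sum_nonneg fun _ _ => Finset.sum_nonneg fun _ _ => abs_nonneg _
  have hM0' : (0 : ℝ) ≤ M := by exact_mod_cast hM0
  refine ⟨1 / ((M : ℝ) + 2), by positivity, fun b hb hbδ n hn hmem => ?_⟩
  obtain ⟨i, hi⟩ := Function.ne_iff.1 hn
  have hM : |(flr (-(b⁻¹ • zVec n))) i| ≤ M :=
    (Finset.single_le_sum (f := fun i => |(flr (-(b⁻¹ • zVec n))) i|)
      (fun _ _ => abs_nonneg _) (Finset.mem_univ i)).trans
    (Finset.single_le_sum (f := fun l : Fin d → ℤ => ∑ i, |l i|)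
      (fun _ _ => Finset.sum_nonneg fun _ _ => abs_nonneg _) hmem)
  simp only [flr, zVec, Pi.neg_apply, Pi.smul_apply, smul_eq_mul] at hM
  have hbi : (M : ℝ) + 2 < b⁻¹ := by
    rw [lt_inv_comm₀ (by positivity) hb]; simpa using hbδ
  have h1 := Int.floor_le (-(b⁻¹ * (n i : ℝ)))
  have h2 := Int.lt_floor_add_one (-(b⁻¹ * (n i : ℝ)))
  have hM' : |(⌊-(b⁻¹ * (n i : ℝ))⌋ : ℝ)| ≤ M := by exact_mod_cast hM
  rw [abs_le] at hM'
  have hi' : n i ≠ 0 := hi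
  rcases lt_or_gt_of_ne hi' with h | h
  · have : (n i : ℝ) ≤ -1 := by exact_mod_cast (by omega : n i ≤ -1)
    nlinarith
  · have : (1 : ℝ) ≤ n i := by exact_mod_cast (by omega : 1 ≤ n i)
    nlinarith

theorem tail_bound {d : ℕ} (g γ : (Fin d → ℝ) → ℂ) (a b : ℝ) (ha : 0 < a) (ha1 : a < 1)
    (hb : 0 < b) (hb1 : b < 1) (s : Finset (Fin d → ℤ))
    (hav : ∀ n : Fin d → ℤ, n ≠ 0 → flr (-(b⁻¹ • zVec n)) ∉ s) :
    ∑' n : {n : Fin d → ℤ // n ≠ 0},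
      ENNReal.ofReal (a ^ d) * eLpNorm (Gabn g γ a b n.1) ∞ volume ≤
    ∑' l : {l : Fin d → ℤ // l ∉ s}, Hmaj d (blockNorm d ∞ g) (blockNorm d ∞ γ) l.1 := by
  have key : ∀ n : {n : Fin d → ℤ // n ≠ 0},
      ENNReal.ofReal (a ^ d) * eLpNorm (Gabn g γ a b n.1) ∞ volume ≤
      Hmaj d (blockNorm d ∞ g) (blockNorm d ∞ γ) (flr (-(b⁻¹ • zVec n.1))) := by
    intro n
    exact term_bound g γ a b ha ha1 n.1
  refine le_trans (ENNReal.tsum_le_tsum key) ?_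
  let φ : {n : Fin d → ℤ // n ≠ 0} → {l : Fin d → ℤ // l ∉ s} := fun n =>
    ⟨flr (-(b⁻¹ • zVec n.1)), hav n.1 n.2⟩
  have hφ : Function.Injective φ := fun n n' h =>
    Subtype.ext (l_inj b hb hb1 (congrArg Subtype.val h))
  exact ENNReal.tsum_comp_le_tsum_of_injective hφ
    (fun l => Hmaj d (blockNorm d ∞ g) (blockNorm d ∞ γ) l.1)

theorem stmt7 {d : ℕ} (g γ : (Fin d → ℝ) → ℂ) (hg : Measurable g) (hγ : Measurable γ)
    (hWg : wienerNorm d g < ∞) (hWγ : wienerNorm d γ < ∞) :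
    Filter.Tendsto
      (fun ab : ℝ × ℝ =>
        ∑' n : {n : Fin d → ℤ // n ≠ 0},
          ENNReal.ofReal (ab.1 ^ d) * eLpNorm (Gabn g γ ab.1 ab.2 n.1) ∞ volume)
      (nhdsWithin (0, 0) (Set.Ioi (0:ℝ) ×ˢ Set.Ioi (0:ℝ)))
      (nhds 0) := by
  obtain ⟨H, hH⟩ : ∃ H, H = Hmaj d (blockNorm d ∞ g) (blockNorm d ∞ γ) := ⟨_, rfl⟩
  have hsum : ∑' l, H l ≠ ∞ := by
    rw [hH]
    exact Hmaj_sum (blockNorm d ∞ g) (blockNorm d ∞ γ) hWg hWγ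
  rw [ENNReal.tendsto_nhds_zero]
  intro ε hε
  obtain ⟨s, hs⟩ := ((ENNReal.tendsto_nhds_zero.1
    (ENNReal.tendsto_tsum_compl_atTop_zero hsum)) ε hε).exists
  obtain ⟨δ, hδ, hav⟩ := l_avoid s
  have hnear : ∀ᶠ ab : ℝ × ℝ in nhdsWithin (0, 0) (Set.Ioi (0:ℝ) ×ˢ Set.Ioi (0:ℝ)),
      ab.1 < 1 ∧ ab.2 < min 1 δ := by
    apply mem_nhdsWithin_of_mem_nhds
    exact prod_mem_nhds (Iio_mem_nhds one_pos) (Iio_mem_nhds (lt_min one_pos hδ))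
  filter_upwards [hnear, self_mem_nhdsWithin] with ab h1 h2
  obtain ⟨ha1, hb1⟩ := h1
  obtain ⟨ha, hb⟩ := h2
  rw [lt_min_iff] at hb1
  simp only [Set.mem_Ioi] at ha hb
  exact (tail_bound g γ ab.1 ab.2 ha ha1 hb hb1.1 s (hav ab.2 hb hb1.2)).trans (hH ▸ hs)
end
end

section
/- Let g, γ ∈ W(ℝ^d), a, b > 0 with ⟨γ, g⟩ ≠ 0, and define (S_{a,b;g,γ} f)(x) = (1/⟨γ,g⟩) ∑_{n∈ℤ^d} a^d G_{a,b;n}(x) f(x − n/b), where G_{a,b;n}(x) = ∑_{k∈ℤ^d} ḡ(x − n/b − ak) γ(x − ak). Then S_{a,b;g,γ} is a bounded operator from W(L^p, ℓ^q) to itself for all 1 ≤ p, q ≤ ∞, with operator norm at most (a^d/|⟨γ,g⟩|)(1 + 1/a)^d (2 + 2b)^d ‖g‖_{W(ℝ^d)} ‖γ‖_{W(ℝ^d)}. -/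
open MeasureTheory ENNReal

noncomputable section

lemma cnt_Ioc (a u v : ℝ) (ha : 0 < a) (huv : u ≤ v) :
    (∑' k : ℤ, (if u < a * k ∧ a * k ≤ v then (1 : ℝ≥0∞) else 0))
      ≤ ENNReal.ofReal ((v - u) / a + 1) := by
  classical
  rw [tsum_eq_sum (s := Finset.Ioc ⌊u / a⌋ ⌊v / a⌋)]
  · refine (Finset.sum_le_sum (g := fun _ => (1 : ℝ≥0∞)) (fun i _ => by split_ifs <;> simp)).trans ?_
    rw [Finset.sum_const, Int.card_Ioc, nsmul_eq_mul, mul_one]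
    rw [← ENNReal.ofReal_natCast]
    apply ENNReal.ofReal_le_ofReal
    have h1 : ⌊u / a⌋ ≤ ⌊v / a⌋ := Int.floor_le_floor (by gcongr)
    have h2 : (((⌊v / a⌋ - ⌊u / a⌋).toNat : ℕ) : ℝ) = (⌊v / a⌋ : ℝ) - ⌊u / a⌋ := by
      have : (((⌊v / a⌋ - ⌊u / a⌋).toNat : ℕ) : ℤ) = ⌊v / a⌋ - ⌊u / a⌋ := Int.toNat_of_nonneg (by omega)
      exact_mod_cast congrArg (fun z : ℤ => (z : ℝ)) this
    rw [h2, sub_div]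
    have := Int.floor_le (v / a)
    have := Int.lt_floor_add_one (u / a)
    linarith
  · intro k hk
    rw [if_neg]
    rintro ⟨h1, h2⟩
    apply hk
    rw [Finset.mem_Ioc]
    constructor
    · rw [Int.floor_lt, div_lt_iff₀ ha]; linarith
    · rw [Int.le_floor, le_div_iff₀ ha]; linarith

lemma cnt_floor (a x : ℝ) (r : ℤ) (ha : 0 < a) :
    (∑' k : ℤ, (if ⌊x - a * k⌋ = r then (1 : ℝ≥0∞) else 0))
      ≤ ENNReal.ofReal (1 + 1 / a) := by
  refine le_trans ?_ ((cnt_Ioc a (x - r - 1) (x - r) ha (by linarith)).trans (le_of_eq ?_))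
  · refine ENNReal.tsum_le_tsum fun k => ?_
    by_cases h : ⌊x - a * k⌋ = r
    · rw [if_pos h, if_pos]
      rw [Int.floor_eq_iff] at h
      constructor <;> linarith
    · rw [if_neg h]; exact zero_le
  · congr 1; ring

/-- one-sided arithmetic progression sum -/
lemma ap_sum (a c e : ℝ) (hc : 0 < c) :
    ∃ R : ℕ, (R = 0 ∨ c * R < 1 - e + c) ∧
      (∑' i : ℕ, (if e + c * i < 1 then ENNReal.ofReal (a + (1 - e - c * i)) else 0))
      = ∑ i ∈ Finset.range R, ENNReal.ofReal (a + (1 - e - c * i)) := by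
  refine ⟨⌈(1 - e) / c⌉₊, ?_, ?_⟩
  · by_cases h : 0 ≤ (1 - e) / c
    · right
      have := Nat.ceil_lt_add_one h
      rw [← sub_lt_iff_lt_add, lt_div_iff₀ hc] at this
      linarith
    · left
      rw [Nat.ceil_eq_zero]; linarith
  · rw [tsum_eq_sum (s := Finset.range ⌈(1 - e) / c⌉₊)]
    · refine Finset.sum_congr rfl fun i hi => ?_
      rw [if_pos]
      rw [Finset.mem_range, Nat.lt_ceil, lt_div_iff₀ hc] at hi
      linarith
    · intro i hi
      rw [if_neg]
      rw [Finset.mem_range, Nat.lt_ceil, lt_div_iff₀ hc] at hi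
      linarith

lemma ap_closed (a c e : ℝ) (R : ℕ) :
    ∑ i ∈ Finset.range R, (a + (1 - e - c * i)) = a * R + R * (1 - e + c / 2) - c * R ^ 2 / 2 := by
  induction R with
  | zero => simp
  | succ n ih => rw [Finset.sum_range_succ, ih]; push_cast; ring

lemma ap_bound (a c e : ℝ) (he : e ≤ c)
    (R : ℕ) (hR : R = 0 ∨ c * R < 1 - e + c) (y : ℝ) (hy : y = 1 - e + c / 2) :
    c * (a * R + R * (1 - e + c / 2) - c * R ^ 2 / 2) ≤
      (if a < c / 2 then (y + a) ^ 2 / 2 else y ^ 2 / 2 + y * a + a * c / 2 - c ^ 2 / 8) := by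
  subst hy
  have h : c * R ≤ 1 - e + c := by
    rcases hR with h | h
    · subst h; simp; linarith
    · exact h.le
  set w := c * (R : ℝ) with hw
  have : c * (a * R + R * (1 - e + c / 2) - c * R ^ 2 / 2) =
    a * w + w * (1 - e + c / 2) - w ^ 2 / 2 := by rw [hw]; ring
  rw [this]
  split_ifs with h1
  · nlinarith [sq_nonneg (w - (1 - e + c/2) - a)]
  · push Not at h1
    nlinarith [mul_nonneg (sub_nonneg.2 h) (by linarith : 0 ≤ 2 * a + (1 - e) - w)]

/-- the key two-sided bound -/
lemma ap_two (a c e : ℝ) (ha : 0 < a) (hac : a ≤ c) (he0 : 0 ≤ e) (he : e ≤ c) :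
    (∑' i : ℕ, (if e + c * i < 1 then ENNReal.ofReal (a + (1 - e - c * i)) else 0)) +
    (∑' i : ℕ, (if (c - e) + c * i < 1 then ENNReal.ofReal (a + (1 - (c - e) - c * i)) else 0))
     ≤ ENNReal.ofReal ((1 + a) * (1 + 1 / c)) := by
  have hc : 0 < c := by linarith
  obtain ⟨R, hR, h1⟩ := ap_sum a c e hc
  obtain ⟨P, hP, h2⟩ := ap_sum a c (c - e) hc
  have hpos : ∀ (e : ℝ) (R : ℕ), (R = 0 ∨ c * R < 1 - e + c) → 
      ∀ i ∈ Finset.range R, 0 ≤ a + (1 - e - c * i) := by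
    intro e R hR i hi
    rw [Finset.mem_range] at hi
    rcases hR with h | h
    · omega
    · have : (i : ℝ) + 1 ≤ R := by exact_mod_cast hi
      nlinarith
  rw [h1, h2, ← ENNReal.ofReal_sum_of_nonneg (hpos _ _ hR), ← ENNReal.ofReal_sum_of_nonneg (hpos _ _ hP),
    ← ENNReal.ofReal_add (Finset.sum_nonneg (hpos _ _ hR)) (Finset.sum_nonneg (hpos _ _ hP))]
  apply ENNReal.ofReal_le_ofReal
  rw [ap_closed, ap_closed]
  by_cases hc2 : c < 2
  · have b1 := ap_bound a c e he R hR _ rfl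
    have b2 := ap_bound a c (c - e) (by linarith) P hP _ rfl
    rw [← mul_le_mul_iff_right₀ hc]
    have : c * ((1 + a) * (1 + 1 / c)) = (1 + a) * (1 + c) := by field_simp; ring
    rw [this, mul_add]
    refine (add_le_add b1 b2).trans ?_
    split_ifs with h
    · nlinarith [mul_nonneg he0 (sub_nonneg.2 he), mul_pos ha hc]
    · nlinarith [mul_nonneg he0 (sub_nonneg.2 he), mul_pos ha hc]
  · push Not at hc2
    have hcinv : 0 ≤ 1 / c := by positivity
    have key : 1 + a ≤ (1 + a) * (1 + 1 / c) := by nlinarith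
    have R1 : ∀ e R, 0 ≤ e → (R = 0 ∨ c * (R:ℕ) < 1 - e + c) → R = 0 ∨ (R = 1 ∧ e < 1) := by
      intro e R he hR
      rcases hR with h | h
      · exact Or.inl h
      · rcases Nat.lt_or_ge R 2 with h' | h'
        · interval_cases R
          · simp
          · right; simp at h ⊢; linarith
        · have : (2 : ℝ) ≤ R := by exact_mod_cast h'
          nlinarith
    refine le_trans ?_ key
    rcases R1 e R he0 hR with h | ⟨h, h'⟩ <;> rcases R1 (c - e) P (by linarith) hP with g | ⟨g, g'⟩ <;>
      subst h <;> subst g <;> norm_num <;> linarith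

lemma ap_int (a c β : ℝ) (ha : 0 < a) (hac : a ≤ c) :
    (∑' n : ℤ, (if |c * n - β| < 1 then ENNReal.ofReal ((1 - |c * n - β|) / a + 1) else 0))
     ≤ ENNReal.ofReal ((1 + 1 / a) * (1 + 1 / c)) := by
  have hc : 0 < c := by linarith
  set n0 := ⌈β / c⌉ with hn0
  set e := c * n0 - β with he
  have he0 : 0 ≤ e := by
    have := Int.le_ceil (β / c)
    rw [div_le_iff₀ hc] at this
    rw [he]; linarith
  have hec : e ≤ c := by
    have := (Int.ceil_lt_add_one (β / c)).le
    rw [← sub_le_iff_le_add, le_div_iff₀ hc] at this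
    rw [he]; linarith
  rw [← (Equiv.addRight n0).tsum_eq, tsum_of_nat_of_neg_add_one ENNReal.summable ENNReal.summable]
  have hscale : ∀ t : ℝ, ENNReal.ofReal ((1 - t) / a + 1) = ENNReal.ofReal (1 / a) * ENNReal.ofReal (a + (1 - t)) := by
    intro t
    rw [← ENNReal.ofReal_mul (by positivity)]
    congr 1; field_simp; ring
  have h1 : ∀ i : ℕ, |c * (((Equiv.addRight n0) (i : ℤ) : ℤ) : ℝ) - β| = e + c * i := by
    intro i
    have : c * (((Equiv.addRight n0) (i : ℤ) : ℤ) : ℝ) - β = e + c * i := by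
      simp [he]; ring
    rw [this, abs_of_nonneg]; positivity
  have h2 : ∀ i : ℕ, |c * (((Equiv.addRight n0) (-((i : ℤ) + 1)) : ℤ) : ℝ) - β| = (c - e) + c * i := by
    intro i
    have : c * (((Equiv.addRight n0) (-((i : ℤ) + 1)) : ℤ) : ℝ) - β = - ((c - e) + c * i) := by
      simp [he]; ring
    rw [this, abs_neg, abs_of_nonneg]
    have : 0 ≤ c - e := by linarith
    positivity
  simp only [h1, h2, hscale]
  have key := ap_two a c e ha hac he0 hec
  have : ENNReal.ofReal ((1 + 1 / a) * (1 + 1 / c)) = ENNReal.ofReal (1 / a) * ENNReal.ofReal ((1 + a) * (1 + 1 / c)) := by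
    rw [← ENNReal.ofReal_mul (by positivity)]
    congr 1; field_simp; ring
  rw [this]
  refine le_trans (le_of_eq ?_) (mul_le_mul_right key _)
  rw [mul_add, ← ENNReal.tsum_mul_left, ← ENNReal.tsum_mul_left]
  congr 1 <;> (congr 1; ext i; rw [mul_ite, mul_zero]; congr 3; ring)

def c1 (a c : ℝ) (r s j : ℤ) (x : ℝ) : ℝ≥0∞ :=
  ∑' n : ℤ, ∑' k : ℤ, if (⌊x - c * n⌋ = j ∧ ⌊x - a * k⌋ = r ∧ ⌊x - c * n - a * k⌋ = s) then 1 else 0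

lemma c1_swap (a c : ℝ) (r s j : ℤ) (x : ℝ) : c1 a c r s j x = c1 c a j s r x := by
  unfold c1
  rw [ENNReal.tsum_comm]
  congr 1; ext n; congr 1; ext k
  congr 1
  rw [sub_right_comm]
  apply propext; tauto

lemma c1_mid (a c : ℝ) (ha : 0 < a) (hc : 0 < c) (r s j : ℤ) (x : ℝ) :
    c1 a c r s j x ≤ ENNReal.ofReal ((1 + 1 / a) * (1 + 1 / c)) := by
  rw [ENNReal.ofReal_mul (by positivity), mul_comm]
  refine le_trans ?_ (mul_le_mul' (cnt_floor c x j hc) (cnt_floor a x r ha))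
  unfold c1
  rw [← ENNReal.tsum_mul_right]
  refine ENNReal.tsum_le_tsum fun n => ?_
  rw [← ENNReal.tsum_mul_left]
  refine ENNReal.tsum_le_tsum fun k => ?_
  split_ifs <;> simp_all

lemma c1_low (a c : ℝ) (ha : 0 < a) (r s j : ℤ) (x : ℝ) (hx : ⌊x⌋ = r + j - s - 1) :
    c1 a c r s j x ≤ ∑' n : ℤ, (if (|c * n - (r - s)| < 1 ∧ c * n - (r - s) < 0) then
      ENNReal.ofReal ((1 - |c * n - (r - s)|) / a + 1) else 0) := by
  unfold c1
  refine ENNReal.tsum_le_tsum fun n => ?_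
  have hx2 := Int.lt_floor_add_one x
  rw [hx] at hx2; push_cast at hx2
  split_ifs with h
  · rw [abs_of_neg h.2] at h ⊢
    refine le_trans ?_ ((cnt_Ioc a (x - s - 1 - c * n) (x - r) ha (by linarith [h.1])).trans (le_of_eq ?_))
    · refine ENNReal.tsum_le_tsum fun k => ?_
      split_ifs with h1 h2
      · simp
      · exfalso
        simp only [Int.floor_eq_iff] at h1
        exact h2 ⟨by linarith [h1.2.2.2], by linarith [h1.2.1.1]⟩
      · simp
      · simp
    · congr 2; congr 1; ring
  · simp only [nonpos_iff_eq_zero, ENNReal.tsum_eq_zero]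
    intro k
    rw [if_neg]
    intro h1
    simp only [Int.floor_eq_iff] at h1
    apply h
    have : c * n - (r - s) < 0 := by linarith [h1.1.1]
    rw [abs_of_neg this]
    exact ⟨by linarith [h1.2.2.2, h1.2.1.1], this⟩

lemma c1_high (a c : ℝ) (ha : 0 < a) (r s j : ℤ) (x : ℝ) (hx : ⌊x⌋ = r + j - s + 1) :
    c1 a c r s j x ≤ ∑' n : ℤ, (if (|c * n - (r - s)| < 1 ∧ ¬ (c * n - (r - s) < 0)) then
      ENNReal.ofReal ((1 - |c * n - (r - s)|) / a + 1) else 0) := by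
  unfold c1
  refine ENNReal.tsum_le_tsum fun n => ?_
  have hx2 := Int.floor_le x
  rw [hx] at hx2; push_cast at hx2
  split_ifs with h
  · rw [abs_of_nonneg (not_lt.1 h.2)] at h ⊢
    refine le_trans ?_ ((cnt_Ioc a (x - r - 1) (x - s - c * n) ha (by linarith [h.1])).trans (le_of_eq ?_))
    · refine ENNReal.tsum_le_tsum fun k => ?_
      split_ifs with h1 h2
      · simp
      · exfalso
        simp only [Int.floor_eq_iff] at h1
        exact h2 ⟨by linarith [h1.2.1.2], by linarith [h1.2.2.1]⟩
      · simp
      · simp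
    · congr 2; congr 1; ring
  · simp only [nonpos_iff_eq_zero, ENNReal.tsum_eq_zero]
    intro k
    rw [if_neg]
    intro h1
    simp only [Int.floor_eq_iff] at h1
    apply h
    have : 0 ≤ c * n - (r - s) := by linarith [h1.1.2]
    rw [abs_of_nonneg this]
    exact ⟨by linarith [h1.2.2.1, h1.2.1.2], not_lt.2 this⟩

lemma c1_zero (a c : ℝ) (r s j : ℤ) (x : ℝ) (h1 : ⌊x⌋ ≠ r + j - s - 1) (h2 : ⌊x⌋ ≠ r + j - s)
    (h3 : ⌊x⌋ ≠ r + j - s + 1) : c1 a c r s j x = 0 := by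
  unfold c1
  simp only [ENNReal.tsum_eq_zero]
  intro n k
  rw [if_neg]
  intro h
  simp only [Int.floor_eq_iff] at h
  have g1 := Int.lt_floor_add_one x
  have g2 := Int.floor_le x
  have k1 : ((r + j - s : ℤ) : ℝ) < (⌊x⌋ : ℝ) + 2 := by push_cast; linarith
  have k2 : (⌊x⌋ : ℝ) < ((r + j - s : ℤ) : ℝ) + 2 := by push_cast; linarith
  have k1' : r + j - s < ⌊x⌋ + 2 := by exact_mod_cast k1
  have k2' : ⌊x⌋ < r + j - s + 2 := by exact_mod_cast k2
  omega

lemma N1_aux (a c : ℝ) (ha : 0 < a) (hac : a ≤ c) (r s j : ℤ) :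
    (∑' l : ℤ, ⨆ x : ℝ, if ⌊x⌋ = l then c1 a c r s j x else 0)
      ≤ ENNReal.ofReal ((1 + 1 / a) * (2 + 2 * (1 / c))) := by
  have hc : 0 < c := by linarith
  set m := r + j - s with hm
  rw [tsum_eq_sum (s := {m - 1, m, m + 1})]
  · rw [Finset.sum_insert (by simp; omega), Finset.sum_insert (by simp), Finset.sum_singleton]
    have hlow := iSup_le (fun x : ℝ => show (if ⌊x⌋ = m - 1 then c1 a c r s j x else 0) ≤ _ by
      split_ifs with h
      · exact c1_low a c ha r s j x h
      · exact zero_le)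
    have hhigh := iSup_le (fun x : ℝ => show (if ⌊x⌋ = m + 1 then c1 a c r s j x else 0) ≤ _ by
      split_ifs with h
      · exact c1_high a c ha r s j x h
      · exact zero_le)
    have hmid := iSup_le (fun x : ℝ => show (if ⌊x⌋ = m then c1 a c r s j x else 0) ≤ _ by
      split_ifs with h
      · exact c1_mid a c ha hc r s j x
      · exact zero_le)
    refine (add_le_add hlow (add_le_add hmid hhigh)).trans ?_
    have : ENNReal.ofReal ((1 + 1 / a) * (2 + 2 * (1 / c))) =
        ENNReal.ofReal ((1 + 1 / a) * (1 + 1 / c)) + ENNReal.ofReal ((1 + 1 / a) * (1 + 1 / c)) := by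
      rw [← ENNReal.ofReal_add (by positivity) (by positivity)]; congr 1; ring
    rw [this, add_left_comm]
    refine add_le_add le_rfl (le_trans (le_of_eq ?_) (ap_int a c (r - s) ha hac))
    rw [← ENNReal.tsum_add]
    congr 1; ext n
    by_cases h : c * (n : ℝ) - (r - s) < 0 <;> simp [h]
  · intro l hl
    simp only [Finset.mem_insert, Finset.mem_singleton, not_or] at hl
    simp only [ENNReal.iSup_eq_zero]
    intro x
    split_ifs with h
    · subst h; exact c1_zero a c r s j x hl.1 hl.2.1 hl.2.2
    · rfl

lemma N1 (a c : ℝ) (ha : 0 < a) (hc : 0 < c) (r s j : ℤ) :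
    (∑' l : ℤ, ⨆ x : ℝ, if ⌊x⌋ = l then c1 a c r s j x else 0)
      ≤ ENNReal.ofReal ((1 + 1 / a) * (2 + 2 * (1 / c))) := by
  rcases le_total a c with h | h
  · exact N1_aux a c ha h r s j
  · simp_rw [c1_swap a c]
    refine (N1_aux c a hc h j s r).trans (le_of_eq ?_)
    congr 1; ring

lemma tsum_pi_prod : ∀ {d : ℕ} (φ : Fin d → ℤ → ℝ≥0∞),
    (∑' k : Fin d → ℤ, ∏ i, φ i (k i)) = ∏ i, ∑' n, φ i n := by
  intro d
  induction d with
  | zero => intro φ; simp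
  | succ d ih =>
    intro φ
    rw [← (Fin.consEquiv (fun _ : Fin (d + 1) => ℤ)).tsum_eq, Fin.prod_univ_succ, ← ih]
    simp only [Fin.consEquiv_apply, Fin.prod_univ_succ, Fin.cons_zero, Fin.cons_succ]
    rw [ENNReal.tsum_prod (f := fun (p : ℤ) (q : Fin d → ℤ) => φ 0 p * ∏ i, φ i.succ (q i))]
    simp only [ENNReal.tsum_mul_left, ENNReal.tsum_mul_right]

def fl {d : ℕ} (x : Fin d → ℝ) : Fin d → ℤ := fun i => ⌊x i⌋

def cd {d : ℕ} (a c : ℝ) (r s j : Fin d → ℤ) (x : Fin d → ℝ) : ℝ≥0∞ :=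
  ∑' n : Fin d → ℤ, ∑' k : Fin d → ℤ,
    if (fl (x - c • zVec n) = j ∧ fl (x - a • zVec k) = r ∧ fl (x - c • zVec n - a • zVec k) = s)
    then 1 else 0

lemma cd_eq {d : ℕ} (a c : ℝ) (r s j : Fin d → ℤ) (x : Fin d → ℝ) :
    cd a c r s j x = ∏ i, c1 a c (r i) (s i) (j i) (x i) := by
  unfold cd c1
  rw [← tsum_pi_prod]
  congr 1; ext n
  rw [← tsum_pi_prod]
  congr 1; ext k
  rw [Finset.prod_ite_zero]
  simp only [Finset.prod_const_one]
  congr 1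
  apply propext
  simp only [funext_iff, fl, zVec, Pi.sub_apply, Pi.smul_apply, smul_eq_mul, Finset.mem_univ, true_imp_iff]
  constructor
  · rintro ⟨h1, h2, h3⟩ i; exact ⟨h1 i, h2 i, h3 i⟩
  · intro h; exact ⟨fun i => (h i).1, fun i => (h i).2.1, fun i => (h i).2.2⟩

lemma Nd {d : ℕ} (a c : ℝ) (ha : 0 < a) (hc : 0 < c) (r s j : Fin d → ℤ) :
    (∑' l : Fin d → ℤ, ⨆ x : Fin d → ℝ, if fl x = l then cd a c r s j x else 0)
      ≤ ENNReal.ofReal ((1 + 1 / a) * (2 + 2 * (1 / c))) ^ d := by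
  have : ENNReal.ofReal ((1 + 1 / a) * (2 + 2 * (1 / c))) ^ d =
    ∏ _i : Fin d, ENNReal.ofReal ((1 + 1 / a) * (2 + 2 * (1 / c))) := by simp
  rw [this]
  refine le_trans ?_ (Finset.prod_le_prod' fun i _ => N1 a c ha hc (r i) (s i) (j i))
  rw [← tsum_pi_prod]
  refine ENNReal.tsum_le_tsum fun l => iSup_le fun x => ?_
  split_ifs with h
  · rw [cd_eq]
    refine Finset.prod_le_prod' fun i _ => ?_
    refine le_trans ?_ (le_iSup _ (x i))
    rw [if_pos (show ⌊x i⌋ = l i from congrFun h i)]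
  · exact zero_le

lemma Rd {d : ℕ} (a c : ℝ) (ha : 0 < a) (hc : 0 < c) (r s : Fin d → ℤ) (x : Fin d → ℝ) :
    (∑' n : Fin d → ℤ, ∑' k : Fin d → ℤ,
      if (fl (x - a • zVec k) = r ∧ fl (x - c • zVec n - a • zVec k) = s) then (1 : ℝ≥0∞) else 0)
      ≤ ENNReal.ofReal ((1 + 1 / a) * (2 + 2 * (1 / c))) ^ d := by
  have h1 : ENNReal.ofReal ((1 + 1 / a) * (2 + 2 * (1 / c))) ^ d =
    ∏ _i : Fin d, ENNReal.ofReal ((1 + 1 / a) * (2 + 2 * (1 / c))) := by simp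
  rw [h1, ENNReal.tsum_comm]
  have h2 : ∀ i : Fin d, (∑' k : ℤ, ∑' n : ℤ,
      if (⌊x i - a * k⌋ = r i ∧ ⌊x i - a * k - c * n⌋ = s i) then (1 : ℝ≥0∞) else 0) ≤
      ENNReal.ofReal ((1 + 1 / a) * (2 + 2 * (1 / c))) := by
    intro i
    calc _ ≤ ∑' k : ℤ, (if ⌊x i - a * k⌋ = r i then (1 : ℝ≥0∞) else 0) * ENNReal.ofReal (1 + 1 / c) := by
          refine ENNReal.tsum_le_tsum fun k => ?_
          split_ifs with h
          · simp only [h, true_and, one_mul]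
            exact cnt_floor c _ _ hc
          · simp [h]
      _ ≤ ENNReal.ofReal (1 + 1 / a) * ENNReal.ofReal (1 + 1 / c) := by
          rw [ENNReal.tsum_mul_right]
          gcongr
          exact cnt_floor a _ _ ha
      _ ≤ _ := by
          rw [← ENNReal.ofReal_mul (by positivity)]
          apply ENNReal.ofReal_le_ofReal
          have : 0 < 1 / c := by positivity
          refine mul_le_mul_of_nonneg_left (by linarith) (by positivity)
  refine le_trans (le_of_eq ?_) (Finset.prod_le_prod' fun i _ => h2 i)
  rw [← tsum_pi_prod]
  congr 1; ext k
  rw [← tsum_pi_prod]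
  congr 1; ext n
  rw [Finset.prod_ite_zero]
  simp only [Finset.prod_const_one]
  congr 1
  apply propext
  simp only [funext_iff, fl, zVec, Pi.sub_apply, Pi.smul_apply, smul_eq_mul, Finset.mem_univ, true_imp_iff]
  constructor
  · rintro ⟨h1, h2⟩ i; exact ⟨h1 i, by rw [sub_right_comm]; exact h2 i⟩
  · intro h; exact ⟨fun i => (h i).1, fun i => by rw [sub_right_comm]; exact (h i).2⟩

def Hk {d : ℕ} (a c : ℝ) (G Γ : (Fin d → ℤ) → ℝ≥0∞) (n : Fin d → ℤ) (x : Fin d → ℝ) : ℝ≥0∞ :=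
  ∑' k : Fin d → ℤ, G (fl (x - c • zVec n - a • zVec k)) * Γ (fl (x - a • zVec k))

def Kx {d : ℕ} (a c : ℝ) (G Γ : (Fin d → ℤ) → ℝ≥0∞) (x : Fin d → ℝ) (j : Fin d → ℤ) : ℝ≥0∞ :=
  ∑' n : Fin d → ℤ, if fl (x - c • zVec n) = j then Hk a c G Γ n x else 0

lemma tsum_pick {d : ℕ} (G Γ : (Fin d → ℤ) → ℝ≥0∞) (s0 r0 : Fin d → ℤ) :
    G s0 * Γ r0 = ∑' r, ∑' s, G s * Γ r * (if r0 = r ∧ s0 = s then 1 else 0) := by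
  rw [tsum_eq_single r0, tsum_eq_single s0]
  · simp
  · intro s hs; simp [hs.symm]
  · intro r hr; simp [hr.symm]

lemma tsum4_comm {α : Type} (F : α → α → α → α → ℝ≥0∞) :
    (∑' n, ∑' k, ∑' r, ∑' s, F n k r s) = ∑' r, ∑' s, ∑' n, ∑' k, F n k r s := by
  have h1 : ∀ n, (∑' k, ∑' r, ∑' s, F n k r s) = ∑' r, ∑' s, ∑' k, F n k r s := by
    intro n
    rw [ENNReal.tsum_comm]
    refine tsum_congr fun r => ENNReal.tsum_comm
  simp_rw [h1]
  rw [ENNReal.tsum_comm]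
  refine tsum_congr fun r => ENNReal.tsum_comm

lemma Kx_eq {d : ℕ} (a c : ℝ) (G Γ : (Fin d → ℤ) → ℝ≥0∞) (x : Fin d → ℝ) (j : Fin d → ℤ) :
    Kx a c G Γ x j = ∑' r, ∑' s, G s * Γ r * cd a c r s j x := by
  unfold Kx Hk cd
  simp only [← ENNReal.tsum_mul_left]
  calc _ = ∑' n : Fin d → ℤ, ∑' k : Fin d → ℤ, ∑' r, ∑' s, G s * Γ r *
        (if (fl (x - c • zVec n) = j ∧ fl (x - a • zVec k) = r ∧ fl (x - c • zVec n - a • zVec k) = s)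
    then 1 else 0) := by
        congr 1; ext n
        split_ifs with h
        · congr 1; ext k
          rw [tsum_pick]
          simp [h]
        · simp [h]
    _ = _ := tsum4_comm _

def BB (d : ℕ) (a c : ℝ) (G Γ : (Fin d → ℤ) → ℝ≥0∞) : ℝ≥0∞ :=
  ENNReal.ofReal ((1 + 1 / a) * (2 + 2 * (1 / c))) ^ d * ((∑' s, G s) * (∑' r, Γ r))

lemma BB_eq (d : ℕ) (a c : ℝ) (G Γ : (Fin d → ℤ) → ℝ≥0∞) :
    BB d a c G Γ = ∑' r, ∑' s, G s * Γ r * ENNReal.ofReal ((1 + 1 / a) * (2 + 2 * (1 / c))) ^ d := by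
  simp only [ENNReal.tsum_mul_right, ENNReal.tsum_mul_left, BB]
  ring

lemma BB_swap (d : ℕ) (a c : ℝ) (G Γ : (Fin d → ℤ) → ℝ≥0∞) : BB d a c G Γ = BB d a c Γ G := by
  unfold BB; ring

lemma Kx_col {d : ℕ} (a c : ℝ) (ha : 0 < a) (hc : 0 < c) (G Γ : (Fin d → ℤ) → ℝ≥0∞) (j : Fin d → ℤ) :
    (∑' l : Fin d → ℤ, ⨆ x : Fin d → ℝ, if fl x = l then Kx a c G Γ x j else 0) ≤ BB d a c G Γ := by
  rw [BB_eq]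
  calc _ ≤ ∑' l : Fin d → ℤ, ∑' r, ∑' s, G s * Γ r *
        ⨆ x : Fin d → ℝ, if fl x = l then cd a c r s j x else 0 := by
        refine ENNReal.tsum_le_tsum fun l => iSup_le fun x => ?_
        split_ifs with h
        · rw [Kx_eq]
          refine ENNReal.tsum_le_tsum fun r => ENNReal.tsum_le_tsum fun s => ?_
          gcongr
          refine le_trans ?_ (le_iSup _ x)
          rw [if_pos h]
        · exact zero_le
    _ = ∑' r, ∑' s, G s * Γ r * ∑' l : Fin d → ℤ, 
        ⨆ x : Fin d → ℝ, if fl x = l then cd a c r s j x else 0 := by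
        rw [ENNReal.tsum_comm]
        congr 1; ext r
        rw [ENNReal.tsum_comm]
        congr 1; ext s
        rw [ENNReal.tsum_mul_left]
    _ ≤ _ := by
        refine ENNReal.tsum_le_tsum fun r => ENNReal.tsum_le_tsum fun s => ?_
        gcongr
        exact Nd a c ha hc r s j

lemma Kx_row {d : ℕ} (a c : ℝ) (ha : 0 < a) (hc : 0 < c) (G Γ : (Fin d → ℤ) → ℝ≥0∞) (x : Fin d → ℝ) :
    (∑' j, Kx a c G Γ x j) ≤ BB d a c G Γ := by
  rw [BB_eq]
  calc _ = ∑' n, Hk a c G Γ n x := by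
        unfold Kx
        rw [ENNReal.tsum_comm]
        congr 1; ext n
        rw [tsum_eq_single (fl (x - c • zVec n))]
        · simp
        · intro j hj; rw [if_neg hj.symm]
    _ = ∑' n : Fin d → ℤ, ∑' k : Fin d → ℤ, ∑' r, ∑' s, G s * Γ r *
        (if (fl (x - a • zVec k) = r ∧ fl (x - c • zVec n - a • zVec k) = s) then 1 else 0) := by
        unfold Hk
        congr 1; ext n
        congr 1; ext k
        rw [tsum_pick]
    _ = _ := tsum4_comm _
    _ ≤ _ := by
        refine ENNReal.tsum_le_tsum fun r => ENNReal.tsum_le_tsum fun s => ?_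
        simp only [ENNReal.tsum_mul_left]
        gcongr
        exact Rd a c ha hc r s x

/-- symmetry of the kernel -/
lemma Kx_symm {d : ℕ} (a c : ℝ) (G Γ : (Fin d → ℤ) → ℝ≥0∞) (y : Fin d → ℝ) (l : Fin d → ℤ) :
    (∑' n : Fin d → ℤ, if fl (y + c • zVec n) = l then Hk a c G Γ n (y + c • zVec n) else 0)
      = Kx a c Γ G y l := by
  unfold Kx Hk
  rw [← (Equiv.neg (Fin d → ℤ)).tsum_eq]
  congr 1; ext n
  have h : y + c • zVec ((Equiv.neg (Fin d → ℤ)) n) = y - c • zVec n := by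
    ext i; simp [zVec]; ring
  have h' : y - c • zVec n - c • zVec ((Equiv.neg (Fin d → ℤ)) n) = y := by
    ext i; simp [zVec]
  rw [h]
  split_ifs
  · congr 1; ext k
    rw [h', mul_comm]
  · rfl

lemma tsum_holder {ι : Type*} (f g : ι → ℝ≥0∞) {p q : ℝ} (hp : 0 ≤ p) (hq : 0 ≤ q) (hpq : p + q = 1) :
    (∑' i, f i ^ p * g i ^ q) ≤ (∑' i, f i) ^ p * (∑' i, g i) ^ q := by
  let _ : MeasurableSpace ι := ⊤
  have := ENNReal.lintegral_mul_norm_pow_le (μ := Measure.count) (f := f) (g := g)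
    measurable_from_top.aemeasurable measurable_from_top.aemeasurable hp hq hpq
  simpa only [lintegral_count] using this

def lq {ι : Type*} (q : ℝ≥0∞) (c : ι → ℝ≥0∞) : ℝ≥0∞ :=
  if q = ∞ then ⨆ k, c k else (∑' k, c k ^ q.toReal) ^ (1 / q.toReal)

lemma lq_mono {ι : Type*} (q : ℝ≥0∞) {c c' : ι → ℝ≥0∞} (h : ∀ k, c k ≤ c' k) : lq q c ≤ lq q c' := by
  unfold lq
  split_ifs
  · exact iSup_mono h
  · refine ENNReal.rpow_le_rpow (ENNReal.tsum_le_tsum fun k => ?_) (by positivity)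
    exact ENNReal.rpow_le_rpow (h k) ENNReal.toReal_nonneg

lemma qpos {q : ℝ≥0∞} (hq : 1 ≤ q) (h : q ≠ ∞) : 1 ≤ q.toReal := by
  have := ENNReal.toReal_mono h hq
  simpa using this

lemma lq_const_mul {ι : Type*} {q : ℝ≥0∞} (hq : 1 ≤ q) (C : ℝ≥0∞) (c : ι → ℝ≥0∞) :
    lq q (fun k => C * c k) = C * lq q c := by
  unfold lq
  split_ifs with h
  · rw [ENNReal.mul_iSup]
  · have h1 := qpos hq h
    have h0 : 0 < q.toReal := by linarith
    simp only [ENNReal.mul_rpow_of_nonneg _ _ h0.le]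
    rw [ENNReal.tsum_mul_left, ENNReal.mul_rpow_of_nonneg _ _ (by positivity), ← ENNReal.rpow_mul,
      mul_one_div_cancel h0.ne', ENNReal.rpow_one]

lemma lq_holder {ι : Type*} {q : ℝ≥0∞} (E D : ι → ℝ≥0∞) {s t : ℝ} (hs : 0 ≤ s) (ht : 0 ≤ t)
    (hst : s + t = 1) :
    lq q (fun k => E k ^ s * D k ^ t) ≤ lq q E ^ s * lq q D ^ t := by
  unfold lq
  split_ifs with h
  · refine iSup_le fun k => ?_
    exact mul_le_mul' (ENNReal.rpow_le_rpow (le_iSup E k) hs) (ENNReal.rpow_le_rpow (le_iSup D k) ht)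
  · have h0 : 0 ≤ q.toReal := ENNReal.toReal_nonneg
    have h1 : 0 ≤ 1 / q.toReal := by positivity
    have := tsum_holder (fun k => E k ^ q.toReal) (fun k => D k ^ q.toReal) hs ht hst
    have := ENNReal.rpow_le_rpow this h1
    rw [ENNReal.mul_rpow_of_nonneg _ _ h1] at this
    refine le_trans (le_of_eq ?_) (this.trans (le_of_eq ?_))
    · congr 1
      refine tsum_congr fun k => ?_
      rw [ENNReal.mul_rpow_of_nonneg _ _ h0]
      simp only [← ENNReal.rpow_mul]
      rw [mul_comm s, mul_comm t]
    · simp only [← ENNReal.rpow_mul]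
      rw [mul_comm s, mul_comm t]

lemma lq_schur {L X J : Type*} {q : ℝ≥0∞} (hq : 1 ≤ q) (K : L → X → J → ℝ≥0∞) (B : ℝ≥0∞)
    (hrow : ∀ l x, ∑' j, K l x j ≤ B) (hcol : ∀ j, ∑' l, ⨆ x, K l x j ≤ B) (c : J → ℝ≥0∞) :
    lq q (fun l => ⨆ x, ∑' j, K l x j * c j) ≤ B * lq q c := by
  unfold lq
  split_ifs with h
  · refine iSup_le fun l => iSup_le fun x => ?_
    calc _ ≤ ∑' j, K l x j * ⨆ k, c k := by
          refine ENNReal.tsum_le_tsum fun j => ?_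
          gcongr
          exact le_iSup c j
      _ ≤ _ := by
          rw [ENNReal.tsum_mul_right]
          gcongr
          exact hrow l x
  · have h1 := qpos hq h
    set Q := q.toReal
    have h0 : 0 < Q := by linarith
    have hQ : 0 ≤ 1 - 1 / Q := by
      rw [sub_nonneg, div_le_one h0]; exact h1
    have step : ∀ l, (⨆ x, ∑' j, K l x j * c j) ^ Q ≤ B ^ (Q - 1) * ∑' j, (⨆ x, K l x j) * c j ^ Q := by
      intro l
      have : (⨆ x, ∑' j, K l x j * c j) ≤ (B ^ (Q - 1) * ∑' j, (⨆ x, K l x j) * c j ^ Q) ^ (1 / Q) := by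
        refine iSup_le fun x => ?_
        have hh := tsum_holder (fun j => K l x j * c j ^ Q) (fun j => K l x j) (p := 1 / Q) (q := 1 - 1 / Q)
          (by positivity) hQ (by ring)
        calc _ = ∑' j, (K l x j * c j ^ Q) ^ (1 / Q) * K l x j ^ (1 - 1 / Q) := by
              refine tsum_congr fun j => ?_
              rw [ENNReal.mul_rpow_of_nonneg _ _ (by positivity), ← ENNReal.rpow_mul,
                mul_one_div_cancel h0.ne', ENNReal.rpow_one, mul_right_comm,
                ← ENNReal.rpow_add_of_nonneg _ _ (by positivity) hQ]
              simp
          _ ≤ _ := hh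
          _ ≤ (∑' j, (⨆ x, K l x j) * c j ^ Q) ^ (1 / Q) * B ^ (1 - 1 / Q) := by
              refine mul_le_mul' (ENNReal.rpow_le_rpow (ENNReal.tsum_le_tsum fun j => ?_) (by positivity))
                (ENNReal.rpow_le_rpow (hrow l x) hQ)
              gcongr
              exact le_iSup (fun x => K l x j) x
          _ = _ := by
              rw [ENNReal.mul_rpow_of_nonneg _ _ (by positivity), ← ENNReal.rpow_mul, mul_comm]
              congr 2
              field_simp
      have := ENNReal.rpow_le_rpow this h0.le
      rwa [← ENNReal.rpow_mul, one_div_mul_cancel h0.ne', ENNReal.rpow_one] at this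
    have tot : (∑' l, (⨆ x, ∑' j, K l x j * c j) ^ Q) ≤ B ^ Q * ∑' j, c j ^ Q := by
      calc _ ≤ ∑' l, B ^ (Q - 1) * ∑' j, (⨆ x, K l x j) * c j ^ Q := ENNReal.tsum_le_tsum step
        _ = B ^ (Q - 1) * ∑' j, (∑' l, ⨆ x, K l x j) * c j ^ Q := by
            rw [ENNReal.tsum_mul_left, ENNReal.tsum_comm]
            simp only [ENNReal.tsum_mul_right]
        _ ≤ B ^ (Q - 1) * ∑' j, B * c j ^ Q := by
            gcongr
            exact hcol _
        _ = _ := by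
            rw [ENNReal.tsum_mul_left, ← mul_assoc]
            congr 1
            nth_rewrite 2 [← ENNReal.rpow_one B]
            rw [← ENNReal.rpow_add_of_nonneg _ _ (by linarith) zero_le_one]
            simp
    have := ENNReal.rpow_le_rpow tot (show 0 ≤ 1 / Q by positivity)
    rwa [ENNReal.mul_rpow_of_nonneg _ _ (by positivity), ← ENNReal.rpow_mul B,
                mul_one_div_cancel h0.ne', ENNReal.rpow_one] at this

lemma amalgam_eq (d : ℕ) (p q : ℝ≥0∞) (f : (Fin d → ℝ) → ℂ) :
    amalgamNorm d p q f = lq q (blockNorm d p f) := rfl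

lemma le_lq {ι : Type*} {q : ℝ≥0∞} (hq : 1 ≤ q) (c : ι → ℝ≥0∞) (k : ι) : c k ≤ lq q c := by
  unfold lq
  split_ifs with h
  · exact le_iSup c k
  · have h1 := qpos hq h
    have h0 : 0 < q.toReal := by linarith
    have := ENNReal.rpow_le_rpow (ENNReal.le_tsum (f := fun k => c k ^ q.toReal) k)
      (show 0 ≤ 1 / q.toReal by positivity)
    rwa [← ENNReal.rpow_mul, mul_one_div_cancel h0.ne', ENNReal.rpow_one] at this

lemma mem_block {d : ℕ} (k : Fin d → ℤ) (x : Fin d → ℝ) : x ∈ block d k ↔ fl x = k := by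
  simp only [block, Set.mem_setOf_eq, funext_iff, fl, Int.floor_eq_iff]

lemma measurable_fl {d : ℕ} : Measurable (fl : (Fin d → ℝ) → (Fin d → ℤ)) := by
  refine measurable_pi_lambda _ fun i => ?_
  exact Int.measurable_floor.comp (measurable_pi_apply i)

lemma measurableSet_block {d : ℕ} (k : Fin d → ℤ) : MeasurableSet (block d k) := by
  have : block d k = fl ⁻¹' {k} := by ext x; simp [mem_block]
  rw [this]
  exact measurable_fl (measurableSet_singleton k)

lemma measurable_comp_fl {d : ℕ} (v : (Fin d → ℤ) → ℝ≥0∞) : Measurable (fun x : Fin d → ℝ => v (fl x)) :=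
  (measurable_of_countable v).comp measurable_fl

lemma lintegral_blocks {d : ℕ} (φ : (Fin d → ℝ) → ℝ≥0∞) :
    ∫⁻ x, φ x = ∑' j, ∫⁻ x in block d j, φ x := by
  rw [← lintegral_iUnion (fun j => measurableSet_block j)]
  · have : (⋃ j, block d j) = Set.univ := by
      ext x; simp [mem_block]
    rw [this, setLIntegral_univ]
  · intro i j hij
    rw [Function.onFun, Set.disjoint_left]
    intro x hx hx'
    rw [mem_block] at hx hx'
    exact hij (hx.symm.trans hx')

lemma ae_shift {d : ℕ} {P : (Fin d → ℝ) → Prop} (h : ∀ᵐ x : Fin d → ℝ, P x) (t : Fin d → ℝ) :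
    ∀ᵐ x : Fin d → ℝ, P (x - t) :=
  (measurePreserving_sub_right volume t).quasiMeasurePreserving.ae h

lemma ae_bound {d : ℕ} (g : (Fin d → ℝ) → ℂ) : ∀ᵐ x : Fin d → ℝ, ‖g x‖ₑ ≤ blockNorm d ∞ g (fl x) := by
  have : ∀ k : Fin d → ℤ, ∀ᵐ x : Fin d → ℝ, ‖(block d k).indicator g x‖ₑ ≤ blockNorm d ∞ g k := by
    intro k
    unfold blockNorm
    rw [eLpNorm_exponent_top]
    exact ae_le_eLpNormEssSup
  filter_upwards [ae_all_iff.2 this] with x hx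
  have := hx (fl x)
  rwa [Set.indicator_of_mem ((mem_block _ _).2 rfl)] at this

lemma measurable_Hk {d : ℕ} (a c : ℝ) (G Γ : (Fin d → ℤ) → ℝ≥0∞) (n : Fin d → ℤ) :
    Measurable (Hk a c G Γ n) := by
  unfold Hk
  refine Measurable.ennreal_tsum fun k => ?_
  refine Measurable.mul ?_ ?_
  · exact (measurable_comp_fl G).comp ((measurable_id.sub_const _).sub_const _)
  · exact (measurable_comp_fl Γ).comp (measurable_id.sub_const _)

def Tk {d : ℕ} (a c : ℝ) (G Γ : (Fin d → ℤ) → ℝ≥0∞) (φ : (Fin d → ℝ) → ℝ≥0∞) (x : Fin d → ℝ) : ℝ≥0∞ :=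
  ∑' n, Hk a c G Γ n x * φ (x - c • zVec n)

lemma measurable_Tk {d : ℕ} (a c : ℝ) (G Γ : (Fin d → ℤ) → ℝ≥0∞) {φ : (Fin d → ℝ) → ℝ≥0∞}
    (hφ : Measurable φ) : Measurable (Tk a c G Γ φ) := by
  unfold Tk
  refine Measurable.ennreal_tsum fun n => (measurable_Hk a c G Γ n).mul ?_
  exact hφ.comp (measurable_id.sub_const _)

lemma measurable_Kx {d : ℕ} (a c : ℝ) (G Γ : (Fin d → ℤ) → ℝ≥0∞) (l : Fin d → ℤ) :
    Measurable (fun x => Kx a c G Γ x l) := by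
  unfold Kx
  refine Measurable.ennreal_tsum fun n => ?_
  refine Measurable.ite ?_ (measurable_Hk a c G Γ n) measurable_const
  exact (measurable_fl.comp (measurable_id.sub_const _)) (measurableSet_singleton l)

lemma Tk_fl {d : ℕ} (a c : ℝ) (G Γ : (Fin d → ℤ) → ℝ≥0∞) (v : (Fin d → ℤ) → ℝ≥0∞) (x : Fin d → ℝ) :
    Tk a c G Γ (fun y => v (fl y)) x = ∑' j, Kx a c G Γ x j * v j := by
  unfold Tk Kx
  simp only [← ENNReal.tsum_mul_right]
  rw [ENNReal.tsum_comm]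
  refine tsum_congr fun n => ?_
  rw [tsum_eq_single (fl (x - c • zVec n))]
  · simp
  · intro j hj; rw [if_neg hj.symm, zero_mul]

lemma Tk_int {d : ℕ} (a c : ℝ) (G Γ : (Fin d → ℤ) → ℝ≥0∞) {u : (Fin d → ℝ) → ℝ≥0∞}
    (hu : Measurable u) (l : Fin d → ℤ) :
    ∫⁻ x in block d l, Tk a c G Γ u x = ∑' j, ∫⁻ y in block d j, u y * Kx a c Γ G y l := by
  classical
  rw [← lintegral_blocks, ← lintegral_indicator (measurableSet_block l)]
  have hm : ∀ n : Fin d → ℤ, Measurable (fun x : Fin d → ℝ => if fl x = l then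
      Hk a c G Γ n x * u (x - c • zVec n) else 0) := by
    intro n
    refine Measurable.ite (measurable_fl (measurableSet_singleton l)) ?_ measurable_const
    exact (measurable_Hk a c G Γ n).mul (hu.comp (measurable_id.sub_const _))
  calc _ = ∫⁻ x, ∑' n, (if fl x = l then Hk a c G Γ n x * u (x - c • zVec n) else 0) := by
        refine lintegral_congr fun x => ?_
        rw [Set.indicator_apply]
        simp only [mem_block]
        split_ifs with h
        · rfl
        · simp
    _ = ∑' n, ∫⁻ x, (if fl x = l then Hk a c G Γ n x * u (x - c • zVec n) else 0) :=
        lintegral_tsum fun n => (hm n).aemeasurable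
    _ = ∑' n, ∫⁻ y, (if fl (y + c • zVec n) = l then Hk a c G Γ n (y + c • zVec n) * u y else 0) := by
        refine tsum_congr fun n => ?_
        rw [← lintegral_add_right_eq_self _ (c • zVec n)]
        simp only [add_sub_cancel_right]
    _ = ∫⁻ y, ∑' n, (if fl (y + c • zVec n) = l then Hk a c G Γ n (y + c • zVec n) * u y else 0) := by
        rw [lintegral_tsum]
        intro n
        have := (hm n).comp (measurable_id.add_const (c • zVec n))
        simp only [Function.comp_def, id, add_sub_cancel_right] at this
        exact this.aemeasurable
    _ = _ := by
        refine lintegral_congr fun y => ?_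
        rw [← Kx_symm, ← ENNReal.tsum_mul_left]
        refine tsum_congr fun n => ?_
        split_ifs
        · rw [mul_comm]
        · simp

lemma dom {d : ℕ} (g γ f : (Fin d → ℝ) → ℂ) (a b : ℝ) (I : ℂ) :
    ∀ᵐ x : Fin d → ℝ, ‖I * ∑' n : Fin d → ℤ, (a:ℂ) ^ d * Gabn g γ a b n x * f (x - b⁻¹ • zVec n)‖ₑ
      ≤ (‖I‖ₑ * ‖(a:ℂ) ^ d‖ₑ) *
        Tk a b⁻¹ (blockNorm d ∞ g) (blockNorm d ∞ γ) (fun y => ‖f y‖ₑ) x := by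
  have h1 : ∀ᵐ x : Fin d → ℝ, ∀ n k : Fin d → ℤ, ‖g (x - b⁻¹ • zVec n - a • zVec k)‖ₑ ≤
      blockNorm d ∞ g (fl (x - b⁻¹ • zVec n - a • zVec k)) := by
    rw [ae_all_iff]; intro n
    rw [ae_all_iff]; intro k
    exact ae_shift (ae_shift (ae_bound g) (a • zVec k)) (b⁻¹ • zVec n)
  have h2 : ∀ᵐ x : Fin d → ℝ, ∀ k : Fin d → ℤ, ‖γ (x - a • zVec k)‖ₑ ≤
      blockNorm d ∞ γ (fl (x - a • zVec k)) := by
    rw [ae_all_iff]; intro k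
    exact ae_shift (ae_bound γ) (a • zVec k)
  filter_upwards [h1, h2] with x hx1 hx2
  rw [enorm_mul, mul_assoc]
  refine mul_le_mul_right ?_ _
  refine enorm_tsum_le_tsum_enorm.trans ?_
  unfold Tk
  rw [← ENNReal.tsum_mul_left]
  refine ENNReal.tsum_le_tsum fun n => ?_
  rw [enorm_mul, enorm_mul, mul_assoc]
  refine mul_le_mul_right ?_ _
  refine mul_le_mul_left ?_ _
  unfold Gabn Hk
  refine enorm_tsum_le_tsum_enorm.trans ?_
  refine ENNReal.tsum_le_tsum fun k => ?_
  rw [enorm_mul]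
  refine mul_le_mul' (le_trans (le_of_eq ?_) (hx1 n k)) (hx2 k)
  exact RCLike.enorm_conj _

def Dl {d : ℕ} (a c : ℝ) (G Γ v : (Fin d → ℤ) → ℝ≥0∞) (l : Fin d → ℤ) : ℝ≥0∞ :=
  ⨆ x : Fin d → ℝ, ∑' j, (if fl x = l then Kx a c G Γ x j else 0) * v j

lemma Tk_le_Dl {d : ℕ} (a c : ℝ) (G Γ v : (Fin d → ℤ) → ℝ≥0∞) (x : Fin d → ℝ) :
    Tk a c G Γ (fun y => v (fl y)) x ≤ Dl a c G Γ v (fl x) := by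
  rw [Tk_fl]
  refine le_trans ?_ (le_iSup _ x)
  simp

lemma Dl_bound {d : ℕ} (a c : ℝ) (ha : 0 < a) (hc : 0 < c) (G Γ v : (Fin d → ℤ) → ℝ≥0∞)
    {q : ℝ≥0∞} (hq : 1 ≤ q) : lq q (Dl a c G Γ v) ≤ BB d a c G Γ * lq q v := by
  refine lq_schur hq (fun l x j => if fl x = l then Kx a c G Γ x j else 0) _ ?_ ?_ v
  · intro l x
    split_ifs
    · exact Kx_row a c ha hc G Γ x
    · simp
  · intro j
    exact Kx_col a c ha hc G Γ j

lemma El_bound {d : ℕ} (a c : ℝ) (ha : 0 < a) (hc : 0 < c) (G Γ v : (Fin d → ℤ) → ℝ≥0∞)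
    (hv : ∀ j, v j ≠ ∞) {u : (Fin d → ℝ) → ℝ≥0∞} (hu : Measurable u)
    (huv : ∀ j, ∫⁻ y in block d j, u y ≤ v j)
    {q : ℝ≥0∞} (hq : 1 ≤ q) :
    lq q (fun l => ∫⁻ x in block d l, Tk a c G Γ u x) ≤ BB d a c G Γ * lq q v := by
  set e : (Fin d → ℤ) → (Fin d → ℤ) → ℝ≥0∞ := fun l j => ∫⁻ y in block d j, u y * Kx a c Γ G y l with he
  have he1 : ∀ l j, e l j ≤ (⨆ y, if fl y = j then Kx a c Γ G y l else 0) * v j := by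
    intro l j
    calc e l j ≤ ∫⁻ y in block d j, u y * (⨆ y, if fl y = j then Kx a c Γ G y l else 0) := by
          refine setLIntegral_mono (hu.mul_const _) fun y hy => ?_
          refine mul_le_mul_right ?_ _
          refine le_trans ?_ (le_iSup _ y)
          rw [if_pos ((mem_block _ _).1 hy)]
      _ ≤ _ := by
          rw [lintegral_mul_const _ hu, mul_comm]
          exact mul_le_mul_right (huv j) _
  have he2 : ∀ j, ∑' l, e l j ≤ BB d a c G Γ * v j := by
    intro j
    have hs : ∑' l, e l j = ∫⁻ y in block d j, ∑' l, u y * Kx a c Γ G y l :=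
      (lintegral_tsum fun l => (hu.mul (measurable_Kx a c Γ G l)).aemeasurable).symm
    rw [hs]
    calc _ ≤ ∫⁻ y in block d j, u y * BB d a c G Γ := by
          refine lintegral_mono fun y => ?_
          rw [ENNReal.tsum_mul_left, BB_swap]
          exact mul_le_mul_right (Kx_row a c ha hc Γ G y) _
      _ ≤ _ := by
          rw [lintegral_mul_const _ hu, mul_comm]
          exact mul_le_mul_right (huv j) _
  have := lq_schur hq (fun l (_ : Unit) j => e l j / v j) (BB d a c G Γ) ?_ ?_ v
  · refine le_trans (lq_mono q fun l => ?_) this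
    rw [iSup_const, Tk_int a c G Γ hu]
    refine ENNReal.tsum_le_tsum fun j => ?_
    by_cases h : v j = 0
    · have := he1 l j
      rw [h, mul_zero] at this
      exact this.trans zero_le
    · rw [ENNReal.div_mul_cancel h (hv j)]
  · intro l _
    rw [BB_swap]
    refine le_trans (ENNReal.tsum_le_tsum fun j => ?_) (Kx_col a c ha hc Γ G l)
    exact ENNReal.div_le_of_le_mul (he1 l j)
  · intro j
    simp only [iSup_const, div_eq_mul_inv]
    rw [ENNReal.tsum_mul_right, ← div_eq_mul_inv]
    exact ENNReal.div_le_of_le_mul (he2 j)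

lemma blockNorm_eq {d : ℕ} {p : ℝ≥0∞} (hp : 1 ≤ p) (hp' : p ≠ ∞) (f : (Fin d → ℝ) → ℂ) (k : Fin d → ℤ) :
    blockNorm d p f k = (∫⁻ x in block d k, ‖f x‖ₑ ^ p.toReal) ^ (1 / p.toReal) := by
  unfold blockNorm
  rw [eLpNorm_indicator_eq_eLpNorm_restrict (measurableSet_block k),
    eLpNorm_eq_lintegral_rpow_enorm_toReal (by intro h; simp [h] at hp) hp']

lemma main_fin {d : ℕ} (a c : ℝ) (ha : 0 < a) (hc : 0 < c) (G Γ : (Fin d → ℤ) → ℝ≥0∞)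
    (f F : (Fin d → ℝ) → ℂ) (hf : Measurable f) (C : ℝ≥0∞)
    (hF : ∀ᵐ x, ‖F x‖ₑ ≤ C * Tk a c G Γ (fun y => ‖f y‖ₑ) x)
    {p q : ℝ≥0∞} (hp : 1 ≤ p) (hp' : p ≠ ∞) (hq : 1 ≤ q) (hv : ∀ j, blockNorm d p f j ≠ ∞) :
    lq q (blockNorm d p F) ≤ C * (BB d a c G Γ * lq q (blockNorm d p f)) := by
  have h1 := qpos hp hp'
  set P := p.toReal with hP
  have h0 : 0 < P := by linarith
  have hP1 : 0 ≤ 1 / P := by positivity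
  have hP2 : 0 ≤ 1 - 1 / P := by
    rw [sub_nonneg, div_le_one h0]; exact h1
  set v := blockNorm d p f with hvdef
  set u : (Fin d → ℝ) → ℝ≥0∞ := fun y => ‖f y‖ₑ ^ P * v (fl y) ^ (1 - P) with hu_def
  have hu : Measurable u := by
    refine Measurable.mul (hf.enorm.pow_const _) ?_
    exact measurable_comp_fl (fun j => v j ^ (1 - P))
  have hvP : ∀ j, ∫⁻ y in block d j, ‖f y‖ₑ ^ P = v j ^ P := by
    intro j
    rw [hvdef, blockNorm_eq hp hp', ← ENNReal.rpow_mul, one_div_mul_cancel h0.ne', ENNReal.rpow_one]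
  have huv : ∀ j, ∫⁻ y in block d j, u y ≤ v j := by
    intro j
    have : ∫⁻ y in block d j, u y = ∫⁻ y in block d j, ‖f y‖ₑ ^ P * v j ^ (1 - P) := by
      refine setLIntegral_congr_fun (measurableSet_block j) fun y hy => ?_
      simp only [hu_def, (mem_block _ _).1 hy]
    rw [this, lintegral_mul_const _ (hf.enorm.pow_const _), hvP]
    by_cases h : v j = 0
    · rw [h, ENNReal.zero_rpow_of_pos h0, zero_mul]
    · rw [← ENNReal.rpow_add _ _ h (hv j)]
      simp
  have hzero : ∀ᵐ y : Fin d → ℝ, v (fl y) = 0 → ‖f y‖ₑ = 0 := by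
    have : ∀ j : Fin d → ℤ, ∀ᵐ y : Fin d → ℝ, y ∈ block d j → v j = 0 → ‖f y‖ₑ = 0 := by
      intro j
      by_cases h : v j = 0
      · have hz := hvP j
        rw [h, ENNReal.zero_rpow_of_pos h0, lintegral_eq_zero_iff (hf.enorm.pow_const _)] at hz
        have hz2 := (ae_restrict_iff' (measurableSet_block j)).1 hz
        filter_upwards [hz2] with y hy hyj _
        have := hy hyj
        simpa [ENNReal.rpow_eq_zero_iff, h0, h0.le] using this
      · exact Filter.Eventually.of_forall fun y _ h' => absurd h' h
    filter_upwards [ae_all_iff.2 this] with y hy h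
    exact hy (fl y) ((mem_block _ _).2 rfl) h
  have hfac : ∀ᵐ y : Fin d → ℝ, ‖f y‖ₑ ≤ u y ^ (1 / P) * v (fl y) ^ (1 - 1 / P) := by
    filter_upwards [hzero] with y hy
    by_cases h : v (fl y) = 0
    · rw [hy h]; exact zero_le
    · refine le_of_eq ?_
      simp only [hu_def]
      rw [ENNReal.mul_rpow_of_nonneg _ _ hP1, ← ENNReal.rpow_mul, ← ENNReal.rpow_mul,
        mul_one_div_cancel h0.ne', ENNReal.rpow_one, mul_assoc, ← ENNReal.rpow_add _ _ h (hv _)]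
      have : (1 - P) * (1 / P) + (1 - 1 / P) = 0 := by field_simp; ring
      rw [this, ENNReal.rpow_zero, mul_one]
  have hfac2 : ∀ᵐ x : Fin d → ℝ, ∀ n : Fin d → ℤ, ‖f (x - c • zVec n)‖ₑ ≤
      u (x - c • zVec n) ^ (1 / P) * v (fl (x - c • zVec n)) ^ (1 - 1 / P) :=
    ae_all_iff.2 fun n => ae_shift hfac _
  have hpt : ∀ᵐ x : Fin d → ℝ, ‖F x‖ₑ ^ P ≤ C ^ P * (Tk a c G Γ u x * Dl a c G Γ v (fl x) ^ (P - 1)) := by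
    filter_upwards [hF, hfac2] with x hx1 hx2
    have hT : Tk a c G Γ (fun y => ‖f y‖ₑ) x ≤
        Tk a c G Γ u x ^ (1 / P) * Dl a c G Γ v (fl x) ^ (1 - 1 / P) := by
      calc _ ≤ ∑' n, (Hk a c G Γ n x * u (x - c • zVec n)) ^ (1 / P) *
            (Hk a c G Γ n x * v (fl (x - c • zVec n))) ^ (1 - 1 / P) := by
            unfold Tk
            refine ENNReal.tsum_le_tsum fun n => ?_
            refine (mul_le_mul_right (hx2 n) _).trans (le_of_eq ?_)
            generalize u (x - c • zVec n) = u0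
            generalize v (fl (x - c • zVec n)) = v0
            rw [ENNReal.mul_rpow_of_nonneg _ _ hP1, ENNReal.mul_rpow_of_nonneg _ _ hP2,
              mul_mul_mul_comm, ← ENNReal.rpow_add_of_nonneg _ _ hP1 hP2]
            simp
        _ ≤ _ := tsum_holder _ _ hP1 hP2 (by ring)
        _ ≤ _ := by
            refine mul_le_mul_right (ENNReal.rpow_le_rpow ?_ hP2) _
            exact Tk_le_Dl a c G Γ v x
    have := ENNReal.rpow_le_rpow (hx1.trans (mul_le_mul_right hT C)) h0.le
    refine this.trans (le_of_eq ?_)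
    rw [ENNReal.mul_rpow_of_nonneg _ _ h0.le, ENNReal.mul_rpow_of_nonneg _ _ h0.le,
      ← ENNReal.rpow_mul, ← ENNReal.rpow_mul, one_div_mul_cancel h0.ne', ENNReal.rpow_one]
    congr 3
    field_simp
  have hblock : ∀ l, blockNorm d p F l ≤
      C * ((∫⁻ x in block d l, Tk a c G Γ u x) ^ (1 / P) * Dl a c G Γ v l ^ (1 - 1 / P)) := by
    intro l
    rw [blockNorm_eq hp hp']
    calc _ ≤ (∫⁻ x in block d l, C ^ P * (Tk a c G Γ u x * Dl a c G Γ v l ^ (P - 1))) ^ (1 / P) := by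
          refine ENNReal.rpow_le_rpow ?_ hP1
          refine lintegral_mono_ae ?_
          refine (ae_restrict_iff' (measurableSet_block l)).2 ?_
          filter_upwards [hpt] with x hx hxl
          rw [(mem_block _ _).1 hxl] at hx
          exact hx
      _ = _ := by
          rw [lintegral_const_mul _ ((measurable_Tk a c G Γ hu).mul_const _),
            lintegral_mul_const _ (measurable_Tk a c G Γ hu), ENNReal.mul_rpow_of_nonneg _ _ hP1,
            ENNReal.mul_rpow_of_nonneg _ _ hP1, ← ENNReal.rpow_mul, ← ENNReal.rpow_mul,
            mul_one_div_cancel h0.ne', ENNReal.rpow_one]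
          congr 3
          field_simp
  refine (lq_mono q hblock).trans ?_
  rw [lq_const_mul hq]
  refine mul_le_mul_right ?_ _
  refine (lq_holder _ _ hP1 hP2 (by ring)).trans ?_
  refine (mul_le_mul' (ENNReal.rpow_le_rpow (El_bound a c ha hc G Γ v hv hu huv hq) hP1)
    (ENNReal.rpow_le_rpow (Dl_bound a c ha hc G Γ v hq) hP2)).trans (le_of_eq ?_)
  rw [← ENNReal.rpow_add_of_nonneg _ _ hP1 hP2]
  simp

lemma main_top {d : ℕ} (a c : ℝ) (ha : 0 < a) (hc : 0 < c) (G Γ : (Fin d → ℤ) → ℝ≥0∞)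
    (f F : (Fin d → ℝ) → ℂ) (C : ℝ≥0∞)
    (hF : ∀ᵐ x, ‖F x‖ₑ ≤ C * Tk a c G Γ (fun y => ‖f y‖ₑ) x)
    {q : ℝ≥0∞} (hq : 1 ≤ q) :
    lq q (blockNorm d ∞ F) ≤ C * (BB d a c G Γ * lq q (blockNorm d ∞ f)) := by
  set v := blockNorm d ∞ f with hvdef
  have hfac2 : ∀ᵐ x : Fin d → ℝ, ∀ n : Fin d → ℤ, ‖f (x - c • zVec n)‖ₑ ≤ v (fl (x - c • zVec n)) :=
    ae_all_iff.2 fun n => ae_shift (ae_bound f) _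
  have hblock : ∀ l, blockNorm d ∞ F l ≤ C * Dl a c G Γ v l := by
    intro l
    unfold blockNorm
    rw [eLpNorm_exponent_top]
    refine eLpNormEssSup_le_of_ae_enorm_bound ?_
    filter_upwards [hF, hfac2] with x hx1 hx2
    by_cases h : x ∈ block d l
    · rw [Set.indicator_of_mem h]
      refine hx1.trans (mul_le_mul_right ?_ _)
      rw [← (mem_block _ _).1 h]
      refine le_trans ?_ (Tk_le_Dl a c G Γ v x)
      exact ENNReal.tsum_le_tsum fun n => mul_le_mul_right (hx2 n) _
    · rw [Set.indicator_of_notMem h]; simp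
  refine (lq_mono q hblock).trans ?_
  rw [lq_const_mul hq]
  exact mul_le_mul_right (Dl_bound a c ha hc G Γ v hq) _

lemma wiener_ne_zero {d : ℕ} (g : (Fin d → ℝ) → ℂ) (h : wienerNorm d g = 0) : ∀ᵐ x, g x = 0 := by
  unfold wienerNorm at h
  rw [ENNReal.tsum_eq_zero] at h
  filter_upwards [ae_bound g] with x hx
  rw [h] at hx
  simpa using hx

/-- Walnut's representation defines a bounded operator on `W(L^p, ℓ^q)`. -/
theorem stmt8 {d : ℕ} (g γ : (Fin d → ℝ) → ℂ) (hg : Measurable g) (hγ : Measurable γ)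
    (hWg : wienerNorm d g < ∞) (hWγ : wienerNorm d γ < ∞)
    (a b : ℝ) (ha : 0 < a) (hb : 0 < b)
    (hip : (∫ x, γ x * (starRingEnd ℂ) (g x)) ≠ 0)
    (p q : ℝ≥0∞) (hp : 1 ≤ p) (hq : 1 ≤ q)
    (f : (Fin d → ℝ) → ℂ) (hf : Measurable f) :
    amalgamNorm d p q
        (fun x => (∫ t, γ t * (starRingEnd ℂ) (g t))⁻¹ *
          ∑' n : Fin d → ℤ, (a:ℂ) ^ d * Gabn g γ a b n x * f (x - b⁻¹ • zVec n))
      ≤ ENNReal.ofReal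
            (a ^ d / ‖∫ t, γ t * (starRingEnd ℂ) (g t)‖ * (1 + 1 / a) ^ d * (2 + 2 * b) ^ d)
          * wienerNorm d g * wienerNorm d γ * amalgamNorm d p q f := by
  have hg0 : wienerNorm d g ≠ 0 := by
    intro h
    apply hip
    rw [integral_eq_zero_of_ae]
    filter_upwards [wiener_ne_zero g h] with x hx
    simp [hx]
  have hγ0 : wienerNorm d γ ≠ 0 := by
    intro h
    apply hip
    rw [integral_eq_zero_of_ae]
    filter_upwards [wiener_ne_zero γ h] with x hx
    simp [hx]
  set I := ∫ t, γ t * (starRingEnd ℂ) (g t) with hI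
  have hIpos : 0 < ‖I‖ := norm_pos_iff.2 hip
  set F : (Fin d → ℝ) → ℂ := fun x => I⁻¹ *
          ∑' n : Fin d → ℤ, (a:ℂ) ^ d * Gabn g γ a b n x * f (x - b⁻¹ • zVec n) with hFdef
  have hF := dom g γ f a b I⁻¹
  have hconst : (‖I⁻¹‖ₑ * ‖(a:ℂ) ^ d‖ₑ) * BB d a b⁻¹ (blockNorm d ∞ g) (blockNorm d ∞ γ) =
      ENNReal.ofReal (a ^ d / ‖I‖ * (1 + 1 / a) ^ d * (2 + 2 * b) ^ d)
          * wienerNorm d g * wienerNorm d γ := by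
    unfold BB
    change _ * (_ * (wienerNorm d g * wienerNorm d γ)) = _
    rw [← ofReal_norm_eq_enorm, ← ofReal_norm_eq_enorm, ← ENNReal.ofReal_mul (norm_nonneg _),
      ← ENNReal.ofReal_pow (by positivity), ← mul_assoc, ← ENNReal.ofReal_mul (by positivity), ← mul_assoc]
    congr 3
    rw [norm_inv, norm_pow, Complex.norm_real, Real.norm_of_nonneg ha.le, mul_pow, one_div b⁻¹, inv_inv]
    field_simp
  rw [amalgam_eq, amalgam_eq, ← hconst, mul_assoc]
  by_cases hp' : p = ∞
  · subst hp'
    exact main_top a b⁻¹ ha (inv_pos.2 hb) _ _ f F _ hF hq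
  · by_cases hv : ∀ j, blockNorm d p f j ≠ ∞
    · exact main_fin a b⁻¹ ha (inv_pos.2 hb) _ _ f F hf _ hF hp hp' hq hv
    · push Not at hv
      obtain ⟨j, hj⟩ := hv
      have : lq q (blockNorm d p f) = ∞ := by
        have := le_lq hq (blockNorm d p f) j
        rw [hj] at this
        exact top_le_iff.1 this
      rw [this, ← mul_assoc, hconst, ENNReal.mul_top]
      · exact le_top
      · refine mul_ne_zero (mul_ne_zero ?_ hg0) hγ0
        rw [Ne, ENNReal.ofReal_eq_zero, not_le]
        positivity
end
end
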